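/- arXiv:2402.08305 — 8 statements merged into one kernel-verified Lean document; each statement's English description precedes it below -/
import Mathlib

section
/- Let f ∈ R = k[x_1,…,x_n] be a nonzero squarefree polynomial and let δ_1,…,δ_n ∈ Der(f) be n derivations tangent to V(f) that are linearly independent over R. Then f divides det(δ_1,…,δ_n), the determinant of their n×n coefficient matrix. -/
open MvPolynomial

/-- The module `Der(f)` of polynomial derivations tangent to `V(f)`, i.e. the
`δ ∈ Der_R` with `δ(f) ∈ (f)`, viewed as a submodule of the module of `k`-linear
derivations of `R = k[x_1, …, x_n]`. -/
def tangentDer {k : Type*} [Field k] {n : ℕ} (f : MvPolynomial (Fin n) k) :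
    Submodule (MvPolynomial (Fin n) k)
      (Derivation k (MvPolynomial (Fin n) k) (MvPolynomial (Fin n) k)) where
  carrier := {δ | f ∣ δ f}
  add_mem' := fun ha hb => by simpa using dvd_add ha hb
  zero_mem' := by simp
  smul_mem' := fun c δ hδ => by simpa using hδ.mul_left c

theorem MvPolynomial.pderiv_eq_zero_of_dvd {σ R : Type*} [CommRing R] [IsDomain R]
    {p : MvPolynomial σ R} {i : σ} (h : p ∣ pderiv i p) : pderiv i p = 0 := by
  by_contra hne
  obtain ⟨c, hc⟩ := h
  have hp : p ≠ 0 := by rintro rfl; simp at hne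
  have hc0 : c ≠ 0 := by rintro rfl; simp [hc] at hne
  have hdeg := congrArg (degreeOf i) hc
  rw [degreeOf_mul_eq hp hc0] at hdeg
  have hlt : ∀ m ∈ (pderiv i p).support, m i < degreeOf i p := by
    intro m hm
    rw [mem_support_iff, coeff_pderiv] at hm
    have := degreeOf_le_iff.1 (le_refl (degreeOf i p)) _ (mem_support_iff.2 (left_ne_zero_of_mul hm))
    simpa using this
  obtain ⟨m, hm⟩ := support_nonempty.2 hne
  have := (degreeOf_lt_iff (Nat.zero_lt_of_lt (hlt m hm))).2 hlt
  lia

theorem MvPolynomial.eq_C_of_forall_pderiv_eq_zero {σ R : Type*} [CommRing R] [IsDomain R]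
    [CharZero R] {p : MvPolynomial σ R} (h : ∀ i, pderiv i p = 0) : p = C (coeff 0 p) := by
  classical
  ext m
  rw [coeff_C]
  split_ifs with hm
  · rw [← hm]
  · obtain ⟨i, hi⟩ := Finsupp.ne_iff.1 (Ne.symm hm)
    have hcoeff := coeff_pderiv (i := i) p (m - Finsupp.single i 1)
    rw [h i, Finsupp.sub_add_single_one_cancel hi, coeff_zero] at hcoeff
    exact (mul_eq_zero.1 hcoeff.symm).resolve_right (Nat.cast_add_one_ne_zero _)

theorem MvPolynomial.exists_not_dvd_pderiv_of_prime {σ k : Type*} [Field k] [CharZero k]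
    {p : MvPolynomial σ k} (hp : Prime p) : ∃ i, ¬ p ∣ pderiv i p := by
  by_contra! h
  have hC := eq_C_of_forall_pderiv_eq_zero fun i => pderiv_eq_zero_of_dvd (h i)
  have h0 : coeff 0 p ≠ 0 := fun h0 => hp.ne_zero (by rw [hC, h0, C_0])
  exact hp.not_isUnit (hC ▸ (isUnit_iff_ne_zero.2 h0).map C)

theorem Squarefree.dvd_of_forall_prime_dvd {R : Type*} [CommRing R] [IsDomain R]
    [UniqueFactorizationMonoid R] {a b : R} (ha : Squarefree a)
    (h : ∀ p, Prime p → p ∣ a → p ∣ b) : a ∣ b := by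
  induction a using UniqueFactorizationMonoid.induction_on_prime with
  | h₁ => exact absurd ha not_squarefree_zero
  | h₂ x hx => exact hx.dvd
  | h₃ a p _ hp ih =>
    have hrel := (squarefree_mul_iff.1 ha).1
    exact hrel.mul_dvd (h p hp (dvd_mul_right p a))
      (ih ha.of_mul_right fun q hq hqa => h q hq (hqa.mul_left p))

theorem Matrix.dvd_det_mul_of_forall_dvd_mulVec {n R : Type*} [Fintype n] [DecidableEq n]
    [CommRing R] {A : Matrix n n R} {v : n → R} {a : R} (h : ∀ i, a ∣ (A.mulVec v) i) (j : n) :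
    a ∣ A.det * v j := by
  have hadj : A.adjugate.mulVec (A.mulVec v) = A.det • v := by
    rw [Matrix.mulVec_mulVec, Matrix.adjugate_mul, Matrix.smul_mulVec, Matrix.one_mulVec]
  have hj : A.det * v j = ∑ i, A.adjugate j i * (A.mulVec v) i := (congrFun hadj j).symm
  rw [hj]
  exact Finset.dvd_sum fun i _ => (h i).mul_left _

theorem MvPolynomial.derivation_apply_eq_sum_pderiv {σ R : Type*} [Fintype σ] [CommRing R]
    (D : Derivation R (MvPolynomial σ R) (MvPolynomial σ R)) (f : MvPolynomial σ R) :
    D f = ∑ j, D (X j) * pderiv j f := by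
  classical
  have hsum (g : MvPolynomial σ R) :
      (∑ j, D (X j) • pderiv j : Derivation R (MvPolynomial σ R) (MvPolynomial σ R)) g =
        ∑ j, D (X j) * pderiv j g := by
    rw [← Derivation.coeFnAddMonoidHom_apply, map_sum, Finset.sum_apply]
    rfl
  have h : D = ∑ j, D (X j) • pderiv j := by
    ext1 i
    simp [hsum, pderiv_X, Pi.single_apply]
  conv_lhs => rw [h]
  exact hsum f

/-- **Saito's divisibility lemma.** If `f` is a nonzero squarefree polynomial and
`δ_1, …, δ_n ∈ Der(f)` are `R`-linearly independent derivations tangent to `V(f)`, then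
`f` divides the determinant of their `n × n` coefficient matrix `(δ_i(x_j))`. -/
theorem saito_divisibility {k : Type*} [Field k] [CharZero k] {n : ℕ}
    (f : MvPolynomial (Fin n) k) (hf0 : f ≠ 0) (hf : Squarefree f)
    (δ : Fin n → Derivation k (MvPolynomial (Fin n) k) (MvPolynomial (Fin n) k))
    (hδ : ∀ i, δ i ∈ tangentDer f)
    (hind : LinearIndependent (MvPolynomial (Fin n) k) δ) :
    f ∣ Matrix.det (Matrix.of fun i j => δ i (X j)) := by
  refine hf.dvd_of_forall_prime_dvd fun p hp hpf => ?_
  obtain ⟨q, rfl⟩ := hpf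
  obtain ⟨j, hj⟩ := exists_not_dvd_pderiv_of_prime hp
  have hpq : ¬ p ∣ q := fun ⟨c, hc⟩ =>
    hp.not_isUnit (hf p ⟨c, by rw [hc, mul_assoc]⟩)
  have hdet := Matrix.dvd_det_mul_of_forall_dvd_mulVec
    (A := Matrix.of fun i j => δ i (X j)) (v := fun j => pderiv j (p * q))
    (fun i => (hδ i).trans (derivation_apply_eq_sum_pderiv (δ i) (p * q)).dvd) j
  have hp' := (dvd_mul_right p q).trans hdet
  rw [pderiv_mul, mul_add, mul_left_comm _ p, dvd_add_left (dvd_mul_right p _)] at hp'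
  exact (hp.dvd_or_dvd hp').resolve_right fun h => (hp.dvd_or_dvd h).elim hj hpq
end

section
/- (Saito's criterion) Let f ∈ R = k[x_1,…,x_n] be a nonzero squarefree polynomial and let δ_1,…,δ_n ∈ Der(f). Then Der(f) = Rδ_1 ⊕ ⋯ ⊕ Rδ_n (i.e. δ_1,…,δ_n form a free basis of the R-module Der(f)) if and only if det(δ_1,…,δ_n) = u·f for some nonzero constant u ∈ k. -/
open MvPolynomial

theorem MvPolynomial.exists_pderiv_not_dvd {k σ : Type*} [Field k] [CharZero k]
    {p : MvPolynomial σ k} (hp : Irreducible p) : ∃ j, ¬ p ∣ pderiv j p := by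
  have hvars : p.vars.Nonempty := by
    by_contra h
    rw [Finset.not_nonempty_iff_eq_empty, vars_eq_empty_iff_eq_C] at h
    have hc : p.coeff 0 ≠ 0 := fun h0 => hp.ne_zero (by rw [h, h0, C_0])
    exact hp.not_isUnit (h ▸ (hc.isUnit.map C))
  obtain ⟨j, hj⟩ := hvars
  have hdeg : 0 < p.degreeOf j := Nat.pos_of_ne_zero (mem_vars_iff_degreeOf_ne_zero.mp hj)
  obtain ⟨d, hd, hdj⟩ := (mem_vars_iff_mem_support j).mp hj
  rw [Finsupp.mem_support_iff] at hdj
  have hne : pderiv j p ≠ 0 := by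
    intro h0
    have h1 := coeff_pderiv (i := j) p (d - Finsupp.single j 1)
    have h2 : d - Finsupp.single j 1 + Finsupp.single j 1 = d :=
      tsub_add_cancel_of_le (Finsupp.single_le_iff.mpr (Nat.one_le_iff_ne_zero.mpr hdj))
    rw [h0, h2, coeff_zero] at h1
    exact mul_ne_zero (mem_support_iff.mp hd) (Nat.cast_add_one_ne_zero _) h1.symm
  have hlt : (pderiv j p).degreeOf j < p.degreeOf j := by
    rw [degreeOf_lt_iff hdeg]
    intro m hm
    rw [mem_support_iff, coeff_pderiv] at hm
    have := monomial_le_degreeOf j (mem_support_iff.mpr (left_ne_zero_of_mul hm))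
    simpa using this
  refine ⟨j, ?_⟩
  rintro ⟨q, hq⟩
  have hq0 : q ≠ 0 := by rintro rfl; exact hne (by simpa using hq)
  rw [hq, degreeOf_mul_eq hp.ne_zero hq0] at hlt
  omega

theorem Derivation.finset_sum_apply {R A M ι : Type*} [CommSemiring R] [CommSemiring A]
    [AddCommMonoid M] [Algebra R A] [Module A M] [Module R M] (s : Finset ι)
    (D : ι → Derivation R A M) (a : A) : (∑ i ∈ s, D i) a = ∑ i ∈ s, D i a := by
  induction s using Finset.cons_induction with
  | empty => simp
  | cons i s hi ih => simp [ih]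

theorem MvPolynomial.derivation_apply_eq_sum {k σ : Type*} [CommRing k] [Fintype σ]
    (D : Derivation k (MvPolynomial σ k) (MvPolynomial σ k)) (p : MvPolynomial σ k) :
    D p = ∑ j, D (X j) * pderiv j p := by
  classical
  have h : D = ∑ j, D (X j) • pderiv j := by
    refine derivation_ext fun i => ?_
    simp [Derivation.finset_sum_apply, pderiv_X, Pi.single_apply]
  conv_lhs => rw [h]
  simp [Derivation.finset_sum_apply]

theorem Squarefree.dvd_of_forall_prime_dvd_s2 {α : Type*} [CommMonoidWithZero α]
    [UniqueFactorizationMonoid α] {f x : α} (hf0 : f ≠ 0) (hf : Squarefree f)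
    (h : ∀ p, Prime p → p ∣ f → p ∣ x) : f ∣ x := by
  induction f using UniqueFactorizationMonoid.induction_on_prime with
  | h₁ => exact absurd rfl hf0
  | h₂ f hu => exact hu.dvd
  | h₃ g p hg hp ih =>
    obtain ⟨y, rfl⟩ := ih hg hf.of_mul_right fun q hq hqg => h q hq (hqg.mul_left p)
    have hpg : ¬ p ∣ g := fun hpg => hp.not_isUnit (hf p (mul_dvd_mul_left p hpg))
    rw [mul_comm p]
    exact mul_dvd_mul_left g ((hp.dvd_or_dvd (h p hp (dvd_mul_right p g))).resolve_left hpg)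

section

variable {k : Type*} [Field k] {n : ℕ} {f : MvPolynomial (Fin n) k}

theorem dvd_derivation_of_prime_dvd (hf : Squarefree f) {p : MvPolynomial (Fin n) k}
    (hp : Prime p) (hpf : p ∣ f)
    {D : Derivation k (MvPolynomial (Fin n) k) (MvPolynomial (Fin n) k)}
    (hD : D ∈ tangentDer f) : p ∣ D p := by
  obtain ⟨g, rfl⟩ := hpf
  have hpg : ¬ p ∣ g := fun hpg => hp.not_isUnit (hf p (mul_dvd_mul_left p hpg))
  have h : p ∣ D (p * g) := (dvd_mul_right p g).trans hD
  rw [Derivation.leibniz, smul_eq_mul, smul_eq_mul, dvd_add_right (dvd_mul_right _ _)] at h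
  exact (hp.dvd_or_dvd h).resolve_left hpg

theorem dvd_det_of_mem_tangentDer [CharZero k] (hf0 : f ≠ 0) (hf : Squarefree f)
    {δ : Fin n → Derivation k (MvPolynomial (Fin n) k) (MvPolynomial (Fin n) k)}
    (hδ : ∀ i, δ i ∈ tangentDer f) :
    f ∣ Matrix.det (Matrix.of fun i j => δ i (X j)) := by
  refine hf.dvd_of_forall_prime_dvd_s2 hf0 fun p hp hpf => ?_
  set M : Matrix (Fin n) (Fin n) (MvPolynomial (Fin n) k) := Matrix.of fun i j => δ i (X j) with hM
  obtain ⟨j, hj⟩ := exists_pderiv_not_dvd hp.irreducible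
  have hgrad : M.mulVec (fun l => pderiv l p) = fun i => δ i p := by
    ext1 i
    rw [derivation_apply_eq_sum]
    rfl
  have hdet : M.det * pderiv j p = ∑ i, M.adjugate j i * δ i p := by
    have h := congrFun (congrArg M.adjugate.mulVec hgrad) j
    rwa [Matrix.mulVec_mulVec, Matrix.adjugate_mul, Matrix.smul_mulVec, Matrix.one_mulVec] at h
  have hdvd : p ∣ M.det * pderiv j p := hdet ▸ Finset.dvd_sum fun i _ =>
    (dvd_derivation_of_prime_dvd hf hp hpf (hδ i)).mul_left _
  exact (hp.dvd_or_dvd hdvd).resolve_right hj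

/-- If derivations `η i` lie in the span of the `δ i`, then the determinant of the `δ i` divides
that of the `η i`. -/
theorem det_dvd_det_of_mem_span
    {δ η : Fin n → Derivation k (MvPolynomial (Fin n) k) (MvPolynomial (Fin n) k)}
    (h : ∀ i, η i ∈ Submodule.span (MvPolynomial (Fin n) k) (Set.range δ)) :
    Matrix.det (Matrix.of fun i j => δ i (X j)) ∣ Matrix.det (Matrix.of fun i j => η i (X j)) := by
  simp_rw [Submodule.mem_span_range_iff_exists_fun] at h
  choose B hB using h
  have hmul : (Matrix.of fun i j => η i (X j)) =
      Matrix.of B * Matrix.of fun i j => δ i (X j) := by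
    ext1 i j
    simp [← hB, Matrix.mul_apply, Derivation.finset_sum_apply]
  rw [hmul, Matrix.det_mul]
  exact dvd_mul_left _ _

theorem smul_mem_tangentDer (D : Derivation k (MvPolynomial (Fin n) k) (MvPolynomial (Fin n) k)) :
    f • D ∈ tangentDer f :=
  dvd_mul_right f (D f)

/-- Tangent derivations whose determinant is divisible by the prime factor `p` of `f`
only once. -/
theorem exists_tangentDer_det_not_sq_dvd [CharZero k] (hf : Squarefree f)
    {p : MvPolynomial (Fin n) k} (hp : Prime p) (hpf : p ∣ f) :
    ∃ η : Fin n → Derivation k (MvPolynomial (Fin n) k) (MvPolynomial (Fin n) k),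
      (∀ i, η i ∈ tangentDer f) ∧ ¬ p * p ∣ Matrix.det (Matrix.of fun i j => η i (X j)) := by
  obtain ⟨j, hj⟩ := exists_pderiv_not_dvd hp.irreducible
  obtain ⟨g, rfl⟩ := hpf
  have hpg : ¬ p ∣ g := fun hpg => hp.not_isUnit (hf p (mul_dvd_mul_left p hpg))
  refine ⟨fun i => if i = j then (p * g) • pderiv j else
    g • (pderiv j p • pderiv i - pderiv i p • pderiv j), fun i => ?_, ?_⟩
  · dsimp only
    split_ifs with hij
    · exact smul_mem_tangentDer _
    · refine ⟨pderiv j p * pderiv i g - pderiv i p * pderiv j g, ?_⟩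
      simp only [Derivation.smul_apply, Derivation.sub_apply, Derivation.leibniz, smul_eq_mul]
      ring
  · have hmat : (Matrix.of fun i l => (if i = j then (p * g) • pderiv j else
        g • (pderiv j p • pderiv i - pderiv i p • pderiv j) :
          Derivation k (MvPolynomial (Fin n) k) (MvPolynomial (Fin n) k)) (X l)) =
        (Matrix.diagonal fun _ => g * pderiv j p).updateCol j
          (fun i => if i = j then p * g else -(g * pderiv i p)) := by
      ext1 i l
      rw [Matrix.updateCol_apply, Matrix.of_apply, Matrix.diagonal_apply]
      by_cases hij : i = j <;> by_cases hlj : l = j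
      · subst hij hlj; simp
      · subst hij; simp [hlj, Ne.symm hlj]
      · subst hlj; simp [hij]
      · by_cases hil : i = l
        · subst hil; simp [hij]
        · simp [hij, hil, hlj, Ne.symm hil]
    rw [hmat, ← Matrix.cramer_apply, Matrix.cramer_eq_adjugate_mulVec, Matrix.adjugate_diagonal,
      Matrix.mulVec_diagonal, if_pos rfl, mul_left_comm]
    intro h
    rcases hp.dvd_or_dvd ((mul_dvd_mul_iff_left hp.ne_zero).mp h) with h | h
    · obtain ⟨i, -, hi⟩ := hp.exists_mem_finset_dvd h
      exact (hp.dvd_or_dvd hi).elim hpg hj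
    · exact hpg h

theorem isUnit_of_det_eq_mul [CharZero k] (hf0 : f ≠ 0) (hf : Squarefree f)
    {δ : Fin n → Derivation k (MvPolynomial (Fin n) k) (MvPolynomial (Fin n) k)}
    (hspan : Submodule.span (MvPolynomial (Fin n) k) (Set.range δ) = tangentDer f)
    {c : MvPolynomial (Fin n) k}
    (hc : Matrix.det (Matrix.of fun i j => δ i (X j)) = f * c) : IsUnit c := by
  have hpow : Matrix.det (Matrix.of fun i j => δ i (X j)) ∣ f ^ n := by
    have h := det_dvd_det_of_mem_span (δ := δ) (η := fun i => f • pderiv i)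
      fun i => hspan ▸ smul_mem_tangentDer _
    have hmat : (Matrix.of fun i j => (f • pderiv i :
        Derivation k (MvPolynomial (Fin n) k) (MvPolynomial (Fin n) k)) (X j)) =
        Matrix.diagonal fun _ => f := by
      ext1 i j
      by_cases hij : i = j
      · subst hij; simp
      · simp [hij, Ne.symm hij]
    rw [hmat] at h
    simpa using h
  have hcf : c ∣ f ^ n := (hc ▸ dvd_mul_left c f).trans hpow
  by_contra hu
  obtain ⟨p, hp, hpc⟩ :=
    WfDvdMonoid.exists_irreducible_factor hu (ne_zero_of_dvd_ne_zero (pow_ne_zero n hf0) hcf)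
  have hpf : p ∣ f := hp.prime.dvd_of_dvd_pow (hpc.trans hcf)
  obtain ⟨η, hη, hsq⟩ := exists_tangentDer_det_not_sq_dvd hf hp.prime hpf
  exact hsq ((hc ▸ mul_dvd_mul hpf hpc).trans
    (det_dvd_det_of_mem_span fun i => hspan ▸ hη i))

theorem linearIndependent_of_det_ne_zero
    {δ : Fin n → Derivation k (MvPolynomial (Fin n) k) (MvPolynomial (Fin n) k)}
    (h : Matrix.det (Matrix.of fun i j => δ i (X j)) ≠ 0) :
    LinearIndependent (MvPolynomial (Fin n) k) δ := by
  rw [Fintype.linearIndependent_iff]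
  intro c hc i
  refine congrFun (Matrix.eq_zero_of_vecMul_eq_zero h (v := c) ?_) i
  ext1 j
  have := congrArg (fun D : Derivation k (MvPolynomial (Fin n) k) _ => D (X j)) hc
  simpa [Derivation.finset_sum_apply, Matrix.vecMul, dotProduct] using this

/-- Cramer's rule for derivations. -/
theorem det_smul_eq_sum
    (δ : Fin n → Derivation k (MvPolynomial (Fin n) k) (MvPolynomial (Fin n) k))
    (η : Derivation k (MvPolynomial (Fin n) k) (MvPolynomial (Fin n) k)) :
    Matrix.det (Matrix.of fun i j => δ i (X j)) • η =
      ∑ i, Matrix.det (Matrix.of fun l j => Function.update δ i η l (X j)) • δ i := by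
  refine derivation_ext fun j => ?_
  have hrow (i : Fin n) : (Matrix.of fun l j => Function.update δ i η l (X j)) =
      (Matrix.of fun l j => δ l (X j)).updateRow i fun j => η (X j) := by
    ext1 l j
    by_cases hl : l = i
    · subst hl; simp
    · simp [hl, Matrix.updateRow_apply]
  have h := congrFun (Matrix.mulVec_cramer (Matrix.of fun l j => δ l (X j)).transpose
    fun j => η (X j)) j
  simp only [hrow, ← Matrix.cramer_transpose_apply]
  simpa [Matrix.mulVec, dotProduct, Derivation.finset_sum_apply, mul_comm] using h.symm

theorem tangentDer_le_span_of_det_eq [CharZero k] (hf0 : f ≠ 0) (hf : Squarefree f)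
    {δ : Fin n → Derivation k (MvPolynomial (Fin n) k) (MvPolynomial (Fin n) k)}
    (hδ : ∀ i, δ i ∈ tangentDer f) {u : k} (hu : u ≠ 0)
    (hdet : Matrix.det (Matrix.of fun i j => δ i (X j)) = C u * f) :
    tangentDer f ≤ Submodule.span (MvPolynomial (Fin n) k) (Set.range δ) := by
  intro η hη
  have hdvd (i : Fin n) :
      f ∣ Matrix.det (Matrix.of fun l j => Function.update δ i η l (X j)) := by
    refine dvd_det_of_mem_tangentDer hf0 hf fun l => ?_
    by_cases hl : l = i
    · subst hl; simpa using hη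
    · simpa [hl] using hδ l
  choose b hb using hdvd
  have hsum := det_smul_eq_sum δ η
  simp only [hdet, hb] at hsum
  have key : (C u : MvPolynomial (Fin n) k) • η = ∑ i, b i • δ i := by
    refine derivation_ext fun j => mul_left_cancel₀ hf0 ?_
    have := congrArg (fun D : Derivation k (MvPolynomial (Fin n) k) _ => D (X j)) hsum
    simpa [Derivation.finset_sum_apply, Finset.mul_sum, mul_assoc, mul_left_comm] using this
  have hη' : η = (C u⁻¹ : MvPolynomial (Fin n) k) • ∑ i, b i • δ i := by
    rw [← key, smul_smul, ← C_mul, inv_mul_cancel₀ hu, C_1, one_smul]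
  rw [hη']
  exact Submodule.smul_mem _ _ (Submodule.sum_mem _ fun i _ =>
    Submodule.smul_mem _ _ (Submodule.subset_span ⟨i, rfl⟩))

end

/-- **Saito's criterion.** For a nonzero squarefree `f ∈ R = k[x_1, …, x_n]` and derivations
`δ_1, …, δ_n ∈ Der(f)`, the module `Der(f)` is the (internal direct) sum `Rδ_1 ⊕ ⋯ ⊕ Rδ_n`,
i.e. `δ_1, …, δ_n` form a free basis of `Der(f)`, if and only if the determinant of their
coefficient matrix equals `u · f` for some nonzero constant `u ∈ k`. -/
theorem saito_criterion {k : Type*} [Field k] [CharZero k] {n : ℕ}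
    (f : MvPolynomial (Fin n) k) (hf0 : f ≠ 0) (hf : Squarefree f)
    (δ : Fin n → Derivation k (MvPolynomial (Fin n) k) (MvPolynomial (Fin n) k))
    (hδ : ∀ i, δ i ∈ tangentDer f) :
    (LinearIndependent (MvPolynomial (Fin n) k) δ ∧
        Submodule.span (MvPolynomial (Fin n) k) (Set.range δ) = tangentDer f) ↔
      ∃ u : k, u ≠ 0 ∧ Matrix.det (Matrix.of fun i j => δ i (X j)) = C u * f := by
  constructor
  · rintro ⟨-, hspan⟩
    obtain ⟨c, hc⟩ := dvd_det_of_mem_tangentDer hf0 hf hδ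
    obtain ⟨u, hu, rfl⟩ := isUnit_iff_eq_C_of_isReduced.mp (isUnit_of_det_eq_mul hf0 hf hspan hc)
    exact ⟨u, hu.ne_zero, hc.trans (mul_comm _ _)⟩
  · rintro ⟨u, hu, hdet⟩
    refine ⟨linearIndependent_of_det_ne_zero ?_, le_antisymm ?_ ?_⟩
    · rw [hdet]
      exact mul_ne_zero (C_ne_zero.mpr hu) hf0
    · exact Submodule.span_le.mpr (Set.range_subset_iff.mpr hδ)
    · exact tangentDer_le_span_of_det_eq hf0 hf hδ hu hdet
end

section
/- Let f_1,…,f_r ∈ R = k[x_1,…,x_n] be pairwise coprime squarefree irreducible polynomials, m = (m_1,…,m_r) positive integers, and let δ_1,…,δ_n ∈ Der_m(f) be R-linearly independent multiderivations. Then the product f_1^{m_1}⋯f_r^{m_r} divides det(δ_1,…,δ_n), the determinant of their n×n coefficient matrix. -/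
open MvPolynomial

/-- The module `Der_m(f) = {δ ∈ Der_R : f_i^{m_i} ∣ δ(f_i) for all i}` of multiderivations,
as a submodule of the module of `k`-linear derivations of `R = k[x_1, …, x_n]`. -/
def multiDer {k : Type*} [Field k] {n r : ℕ}
    (f : Fin r → MvPolynomial (Fin n) k) (m : Fin r → ℕ) :
    Submodule (MvPolynomial (Fin n) k)
      (Derivation k (MvPolynomial (Fin n) k) (MvPolynomial (Fin n) k)) where
  carrier := {δ | ∀ i, f i ^ m i ∣ δ (f i)}
  add_mem' := fun ha hb i => by simpa using dvd_add (ha i) (hb i)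
  zero_mem' := fun i => by simp
  smul_mem' := fun c δ hδ i => by simpa using (hδ i).mul_left c

/-- Over a domain of characteristic zero, a polynomial does not divide its partial derivative with
respect to a variable that occurs in it. -/
theorem MvPolynomial.not_dvd_pderiv_of_mem_vars {R σ : Type*} [CommRing R] [IsDomain R]
    [CharZero R] {f : MvPolynomial σ R} {j : σ} (hj : j ∈ f.vars) : ¬ f ∣ pderiv j f := by
  classical
  obtain ⟨d, hd, hdj⟩ := (mem_vars_iff_mem_support j).1 hj
  have hd1 : Finsupp.single j 1 ≤ d := by
    rw [Finsupp.single_le_iff]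
    exact Nat.one_le_iff_ne_zero.2 (Finsupp.mem_support_iff.1 hdj)
  have hdpos : 0 < d j := Nat.pos_of_ne_zero (Finsupp.mem_support_iff.1 hdj)
  have hp : pderiv j f ≠ 0 := by
    intro h
    have hc := coeff_pderiv (i := j) f (d - Finsupp.single j 1)
    rw [h, coeff_zero, tsub_add_cancel_of_le hd1] at hc
    exact mul_ne_zero (mem_support_iff.1 hd) (Nat.cast_add_one_ne_zero _) hc.symm
  rintro ⟨g, hg⟩
  have hf : f ≠ 0 := by
    rintro rfl
    simp at hj
  have hg0 : g ≠ 0 := by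
    rintro rfl
    exact hp (by simpa using hg)
  have hlt : degreeOf j (pderiv j f) < degreeOf j f := by
    rw [degreeOf_lt_iff (hdpos.trans_le (monomial_le_degreeOf j hd))]
    intro e he
    rw [mem_support_iff, coeff_pderiv] at he
    have := monomial_le_degreeOf j (mem_support_iff.2 (left_ne_zero_of_mul he))
    simp at this
    omega
  rw [hg, degreeOf_mul_eq hf hg0] at hlt
  omega

/-- A derivation of a polynomial ring is determined by its values on the variables, through the
partial derivatives. -/
theorem MvPolynomial.derivation_eq_sum_pderiv {R σ : Type*} [CommRing R] [Fintype σ]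
    (D : Derivation R (MvPolynomial σ R) (MvPolynomial σ R)) (f : MvPolynomial σ R) :
    D f = ∑ j, D (X j) * pderiv j f := by
  classical
  have hs (g : MvPolynomial σ R) :
      (∑ j, D (X j) • pderiv j) g = ∑ j, D (X j) * pderiv j g := by
    exact (congrFun (map_sum Derivation.coeFnAddMonoidHom
      (fun j => D (X j) • pderiv (R := R) j) Finset.univ) g).trans (Finset.sum_apply _ _ _)
  have h : D = ∑ j, D (X j) • pderiv j := by
    ext1 i
    simp [hs, pderiv_X, Pi.single_apply]
  rw [← hs, ← h]

/-- If every entry of `A *ᵥ v` is divisible by `a`, then so is every entry of `A.det • v`. -/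
theorem Matrix.dvd_det_mul_of_dvd_mulVec {R ι : Type*} [CommRing R] [Fintype ι] [DecidableEq ι]
    {A : Matrix ι ι R} {v : ι → R} {a : R} (h : ∀ i, a ∣ (A.mulVec v) i) (j : ι) :
    a ∣ A.det * v j := by
  have key : A.adjugate.mulVec (A.mulVec v) = A.det • v := by
    rw [Matrix.mulVec_mulVec, Matrix.adjugate_mul, Matrix.smul_mulVec, Matrix.one_mulVec]
  have hj := congrFun key j
  rw [Pi.smul_apply, smul_eq_mul] at hj
  rw [← hj]
  exact Finset.dvd_sum fun i _ => (h i).mul_left _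

/-- If `f_1, …, f_r ∈ R = k[x_1, …, x_n]` are pairwise coprime squarefree irreducible
polynomials, `m = (m_1, …, m_r)` are positive integers and `δ_1, …, δ_n ∈ Der_m(f)` are
`R`-linearly independent multiderivations, then `f_1^{m_1} ⋯ f_r^{m_r}` divides the
determinant of their `n × n` coefficient matrix `(δ_i(x_j))`. -/
theorem multiDer_divisibility {k : Type*} [Field k] [CharZero k] {n r : ℕ}
    (f : Fin r → MvPolynomial (Fin n) k) (m : Fin r → ℕ)
    (hcop : ∀ i j, i ≠ j → IsRelPrime (f i) (f j))
    (hsqf : ∀ i, Squarefree (f i)) (hirr : ∀ i, Irreducible (f i))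
    (hm : ∀ i, 0 < m i)
    (δ : Fin n → Derivation k (MvPolynomial (Fin n) k) (MvPolynomial (Fin n) k))
    (hδ : ∀ i, δ i ∈ multiDer f m)
    (hind : LinearIndependent (MvPolynomial (Fin n) k) δ) :
    (∏ i, f i ^ m i) ∣ Matrix.det (Matrix.of fun i j => δ i (X j)) := by
  refine Finset.prod_dvd_of_isRelPrime (fun i _ j _ hij => (hcop i j hij).pow) fun i _ => ?_
  have hvars : (f i).vars.Nonempty := by
    rw [Finset.nonempty_iff_ne_empty, Ne, vars_eq_empty_iff_eq_C]
    intro hc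
    refine (hirr i).not_isUnit ?_
    rw [hc]
    exact (isUnit_iff_ne_zero.2 fun h0 => (hirr i).ne_zero (by rw [hc, h0, C_0])).map C
  obtain ⟨j, hj⟩ := hvars
  refine (hirr i).prime.pow_dvd_of_dvd_mul_right _ (not_dvd_pderiv_of_mem_vars hj)
    (Matrix.dvd_det_mul_of_dvd_mulVec (v := fun l => pderiv l (f i)) (fun l => ?_) j)
  have h := hδ l i
  rwa [derivation_eq_sum_pderiv] at h
end

section
/- (Saito–Ziegler criterion for multiderivations) Let f_1,…,f_r ∈ R = k[x_1,…,x_n] be pairwise coprime squarefree irreducible polynomials, m = (m_1,…,m_r) positive integers, and δ_1,…,δ_n ∈ Der_m(f). Then Der_m(f) = Rδ_1 ⊕ ⋯ ⊕ Rδ_n (i.e. δ_1,…,δ_n form a free basis of Der_m(f)) if and only if det(δ_1,…,δ_n) = u·f_1^{m_1}⋯f_r^{m_r} for some nonzero constant u ∈ k. -/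
open MvPolynomial

namespace MvPolynomial

variable {k σ : Type*}

/-- In characteristic zero, a non-constant polynomial does not divide its partial derivative with
respect to a variable occurring in it. -/
theorem not_dvd_pderiv_of_mem_vars_s7 [Field k] [CharZero k] {p : MvPolynomial σ k} {a : σ}
    (ha : a ∈ p.vars) : ¬ p ∣ pderiv a p := by
  classical
  obtain ⟨d, hd, hda⟩ := (mem_vars_iff_mem_support a).1 ha
  have hpos : 0 < d a := Nat.pos_of_ne_zero (Finsupp.mem_support_iff.1 hda)
  have hdeg : 0 < p.degreeOf a := hpos.trans_le (degreeOf_le_iff.1 le_rfl d hd)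
  have hne : pderiv a p ≠ 0 := by
    intro h
    have hc := congrArg (coeff (d - Finsupp.single a 1)) h
    rw [coeff_pderiv, tsub_add_cancel_of_le (by simpa using Nat.succ_le_of_lt hpos), coeff_zero] at hc
    rcases mul_eq_zero.1 hc with h0 | h0
    · exact mem_support_iff.1 hd h0
    · exact Nat.cast_add_one_ne_zero _ h0
  have hlt : (pderiv a p).degreeOf a < p.degreeOf a := by
    refine (degreeOf_lt_iff hdeg).2 fun s hs => ?_
    rw [mem_support_iff, coeff_pderiv] at hs
    have := degreeOf_le_iff.1 (le_refl (p.degreeOf a)) _ (mem_support_iff.2 (left_ne_zero_of_mul hs))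
    simpa using this
  rintro ⟨q, hq⟩
  have hpq : p ≠ 0 ∧ q ≠ 0 := by
    rw [hq] at hne
    exact ⟨left_ne_zero_of_mul hne, right_ne_zero_of_mul hne⟩
  rw [hq, degreeOf_mul_eq hpq.1 hpq.2] at hlt
  omega

theorem exists_not_dvd_pderiv [Field k] [CharZero k] {p : MvPolynomial σ k}
    (hp : Irreducible p) : ∃ a, ¬ p ∣ pderiv a p := by
  obtain ⟨a, ha⟩ : p.vars.Nonempty := by
    rw [Finset.nonempty_iff_ne_empty]
    intro h
    obtain ⟨c, rfl⟩ : ∃ c, p = C c := ⟨_, vars_eq_empty_iff_eq_C.1 h⟩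
    refine hp.not_isUnit ((IsUnit.mk0 c ?_).map C)
    rintro rfl
    exact hp.ne_zero C_0
  exact ⟨a, not_dvd_pderiv_of_mem_vars_s7 ha⟩

theorem derivation_sum_apply [CommRing k] {ι : Type*} (s : Finset ι)
    (D : ι → Derivation k (MvPolynomial σ k) (MvPolynomial σ k)) (p : MvPolynomial σ k) :
    (∑ i ∈ s, D i) p = ∑ i ∈ s, D i p := by
  rw [← Derivation.coeFnAddMonoidHom_apply, map_sum, Finset.sum_apply]
  rfl

theorem derivation_eq_sum_smul_pderiv [CommRing k] [Fintype σ]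
    (D : Derivation k (MvPolynomial σ k) (MvPolynomial σ k)) :
    D = ∑ j, D (X j) • pderiv j := by
  classical
  refine derivation_ext fun i => ?_
  simp [derivation_sum_apply, pderiv_X, Pi.single_apply]

theorem derivation_apply_eq_sum_s7 [CommRing k] [Fintype σ]
    (D : Derivation k (MvPolynomial σ k) (MvPolynomial σ k)) (p : MvPolynomial σ k) :
    D p = ∑ j, D (X j) * pderiv j p := by
  conv_lhs => rw [derivation_eq_sum_smul_pderiv D]
  simp [derivation_sum_apply]

end MvPolynomial

/-- The coefficient matrix of a family of derivations with respect to the partial derivatives. -/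
noncomputable abbrev derivationMatrix {k : Type*} [Field k] {n : ℕ}
    (δ : Fin n → Derivation k (MvPolynomial (Fin n) k) (MvPolynomial (Fin n) k)) :
    Matrix (Fin n) (Fin n) (MvPolynomial (Fin n) k) :=
  Matrix.of fun i j => δ i (X j)

section Saito

open scoped Matrix

variable {k : Type*} [Field k] {n r : ℕ}
  {f : Fin r → MvPolynomial (Fin n) k} {m : Fin r → ℕ}

theorem mem_multiDer {D : Derivation k (MvPolynomial (Fin n) k) (MvPolynomial (Fin n) k)} :
    D ∈ multiDer f m ↔ ∀ i, f i ^ m i ∣ D (f i) :=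
  Iff.rfl

theorem prod_pow_dvd_det_derivationMatrix [CharZero k]
    (hcop : ∀ i j, i ≠ j → IsRelPrime (f i) (f j)) (hirr : ∀ i, Irreducible (f i))
    {δ : Fin n → Derivation k (MvPolynomial (Fin n) k) (MvPolynomial (Fin n) k)}
    (hδ : ∀ i, δ i ∈ multiDer f m) :
    ∏ i, f i ^ m i ∣ (derivationMatrix δ).det := by
  refine Fintype.prod_dvd_of_isRelPrime (fun i j hij => (hcop i j hij).pow) fun i => ?_
  obtain ⟨a, ha⟩ := exists_not_dvd_pderiv (hirr i)
  choose v hv using fun j => mem_multiDer.1 (hδ j) i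
  have hmul : derivationMatrix δ *ᵥ (fun j => pderiv j (f i)) = f i ^ m i • v := by
    ext1 j
    simpa [Matrix.mulVec, dotProduct, ← derivation_apply_eq_sum_s7] using hv j
  have hadj := congrArg (fun w => ((derivationMatrix δ).adjugate *ᵥ w) a) hmul
  simp only [Matrix.mulVec_mulVec, Matrix.adjugate_mul, Matrix.smul_mulVec, Matrix.one_mulVec,
    Matrix.mulVec_smul, Pi.smul_apply, smul_eq_mul] at hadj
  exact (hirr i).prime.pow_dvd_of_dvd_mul_right _ ha ⟨_, hadj⟩

theorem det_smul_eq_sum_s7 (δ : Fin n → Derivation k (MvPolynomial (Fin n) k) (MvPolynomial (Fin n) k))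
    (D : Derivation k (MvPolynomial (Fin n) k) (MvPolynomial (Fin n) k)) :
    (derivationMatrix δ).det • D =
      ∑ i, (derivationMatrix (Function.update δ i D)).det • δ i := by
  refine derivation_ext fun j => ?_
  have h := congrFun (Matrix.mulVec_cramer (derivationMatrix δ)ᵀ fun j => D (X j)) j
  have hupd : ∀ i, (derivationMatrix δ).updateRow i (fun j => D (X j)) =
      derivationMatrix (Function.update δ i D) := by
    intro i
    ext1 a b
    by_cases hai : a = i
    · subst hai; simp
    · simp [hai]
  simp only [Matrix.mulVec, dotProduct, Matrix.cramer_transpose_apply, Matrix.det_transpose, hupd,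
    Matrix.transpose_apply, Pi.smul_apply] at h
  simp only [Derivation.smul_apply, derivation_sum_apply]
  rw [← h]
  exact Finset.sum_congr rfl fun i _ => by simp [mul_comm]

theorem linearIndependent_of_det_derivationMatrix_ne_zero
    {δ : Fin n → Derivation k (MvPolynomial (Fin n) k) (MvPolynomial (Fin n) k)}
    (h : (derivationMatrix δ).det ≠ 0) : LinearIndependent (MvPolynomial (Fin n) k) δ := by
  rw [Fintype.linearIndependent_iff]
  intro c hc
  refine congrFun (Matrix.eq_zero_of_vecMul_eq_zero h (funext fun j => ?_))
  simpa [Matrix.vecMul, dotProduct, derivation_sum_apply] using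
    DFunLike.congr_fun hc (X j : MvPolynomial (Fin n) k)

theorem det_derivationMatrix_dvd_of_mem_span
    {δ ε : Fin n → Derivation k (MvPolynomial (Fin n) k) (MvPolynomial (Fin n) k)}
    (h : ∀ i, ε i ∈ Submodule.span (MvPolynomial (Fin n) k) (Set.range δ)) :
    (derivationMatrix δ).det ∣ (derivationMatrix ε).det := by
  choose A hA using fun i => (Submodule.mem_span_range_iff_exists_fun _).1 (h i)
  have hmul : derivationMatrix ε = Matrix.of A * derivationMatrix δ := by
    ext1 i j
    simp [Matrix.mul_apply, ← hA i, derivation_sum_apply]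
  rw [hmul, Matrix.det_mul]
  exact dvd_mul_left _ _

theorem smul_mem_multiDer {g : MvPolynomial (Fin n) k} (hg : ∀ i, f i ^ m i ∣ g)
    (D : Derivation k (MvPolynomial (Fin n) k) (MvPolynomial (Fin n) k)) :
    g • D ∈ multiDer f m :=
  mem_multiDer.2 fun i => by simpa using (hg i).mul_right (D (f i))

theorem det_derivationMatrix_smul_pderiv (g : MvPolynomial (Fin n) k) :
    (derivationMatrix fun j => g • pderiv j).det = g ^ n := by
  have h : (derivationMatrix fun j => g • pderiv j) = Matrix.diagonal fun _ => g := by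
    ext1 i j
    simp [pderiv_X, Pi.single_apply, Matrix.diagonal_apply, eq_comm]
  simp [h]

/-- The `∂_a`-direction scaled by `c`, completed by the Koszul derivations
`(∂_a p) ∂_j - (∂_j p) ∂_a`, which annihilate `p`. -/
noncomputable def koszulFamily (p c : MvPolynomial (Fin n) k) (a : Fin n) (j : Fin n) :
    Derivation k (MvPolynomial (Fin n) k) (MvPolynomial (Fin n) k) :=
  if j = a then c • pderiv a else pderiv a p • pderiv j - pderiv j p • pderiv a

theorem koszulFamily_apply (p c : MvPolynomial (Fin n) k) (a j : Fin n) :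
    koszulFamily p c a j p = if j = a then c * pderiv a p else 0 := by
  unfold koszulFamily
  split_ifs <;> simp [mul_comm]

theorem det_derivationMatrix_smul_koszulFamily (p c g : MvPolynomial (Fin n) k) (a : Fin n) :
    (derivationMatrix fun j => g • koszulFamily p c a j).det =
      g ^ n * (pderiv a p ^ (n - 1) * c) := by
  have h : (derivationMatrix fun j => g • koszulFamily p c a j) =
      g • (Matrix.diagonal fun _ => pderiv a p).updateCol a
        (fun j => if j = a then c else - pderiv j p) := by
    ext1 i j
    have hcol : ∀ l, (koszulFamily p c a i) (X l) =
        (Matrix.diagonal fun _ => pderiv a p).updateCol a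
          (fun j => if j = a then c else - pderiv j p) i l := by
      intro l
      rw [koszulFamily, Matrix.updateCol_apply, Matrix.diagonal_apply]
      split_ifs <;> simp_all [pderiv_X, Pi.single_apply, eq_comm]
    simp [hcol]
  rw [h, Matrix.det_smul, ← Matrix.cramer_apply, Matrix.cramer_eq_adjugate_mulVec,
    Matrix.adjugate_diagonal, Matrix.mulVec_diagonal]
  simp

theorem smul_koszulFamily_mem_multiDer (i : Fin r) (a j : Fin n) :
    (∏ l ∈ Finset.univ.erase i, f l ^ m l) • koszulFamily (f i) (f i ^ m i) a j ∈
      multiDer f m := by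
  refine mem_multiDer.2 fun l => ?_
  rw [Derivation.smul_apply, smul_eq_mul]
  by_cases hl : l = i
  · subst hl
    rw [koszulFamily_apply]
    split_ifs
    · exact (dvd_mul_right _ _).mul_left _
    · simp
  · exact (Finset.dvd_prod_of_mem (fun l => f l ^ m l)
      (Finset.mem_erase.2 ⟨hl, Finset.mem_univ l⟩)).mul_right _

theorem not_dvd_prod_erase_pow (hcop : ∀ i j, i ≠ j → IsRelPrime (f i) (f j))
    (hirr : ∀ i, Irreducible (f i)) (i : Fin r) :
    ¬ f i ∣ ∏ l ∈ Finset.univ.erase i, f l ^ m l := by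
  intro h
  obtain ⟨l, hl, hdvd⟩ := (hirr i).prime.exists_mem_finset_dvd h
  exact (hirr i).not_isUnit ((hcop i l (Finset.ne_of_mem_erase hl).symm) dvd_rfl
    ((hirr i).prime.dvd_of_dvd_pow hdvd))

theorem isUnit_of_det_derivationMatrix_eq_mul [CharZero k]
    (hcop : ∀ i j, i ≠ j → IsRelPrime (f i) (f j)) (hirr : ∀ i, Irreducible (f i))
    {δ : Fin n → Derivation k (MvPolynomial (Fin n) k) (MvPolynomial (Fin n) k)}
    (hspan : Submodule.span (MvPolynomial (Fin n) k) (Set.range δ) = multiDer f m)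
    {g : MvPolynomial (Fin n) k} (hg : (derivationMatrix δ).det = (∏ i, f i ^ m i) * g) :
    IsUnit g := by
  have hF : ∏ i, f i ^ m i ≠ 0 :=
    Finset.prod_ne_zero_iff.2 fun i _ => pow_ne_zero _ (hirr i).ne_zero
  have key : ∀ ε : Fin n → Derivation k (MvPolynomial (Fin n) k) (MvPolynomial (Fin n) k),
      (∀ j, ε j ∈ multiDer f m) → (∏ i, f i ^ m i) * g ∣ (derivationMatrix ε).det :=
    fun ε hε => hg ▸ det_derivationMatrix_dvd_of_mem_span fun j => hspan ▸ hε j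
  have hpow : g ∣ (∏ i, f i ^ m i) ^ n := by
    rw [← det_derivationMatrix_smul_pderiv]
    exact (dvd_mul_left _ _).trans (key _ fun j => smul_mem_multiDer
      (fun i => Finset.dvd_prod_of_mem (fun i => f i ^ m i) (Finset.mem_univ i)) _)
  by_contra hunit
  obtain ⟨p, hp, hpg⟩ := WfDvdMonoid.exists_irreducible_factor hunit
    (ne_zero_of_dvd_ne_zero (pow_ne_zero _ hF) hpow)
  obtain ⟨i, -, hpi⟩ := hp.prime.exists_mem_finset_dvd
    (hp.prime.dvd_of_dvd_pow (hpg.trans hpow))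
  have hig : f i ∣ g :=
    ((hp.associated_of_dvd (hirr i) (hp.prime.dvd_of_dvd_pow hpi)).symm.dvd).trans hpg
  obtain ⟨a, ha⟩ := exists_not_dvd_pderiv (hirr i)
  have hn : n = n - 1 + 1 := (Nat.succ_pred_eq_of_pos a.pos).symm
  set G := ∏ l ∈ Finset.univ.erase i, f l ^ m l with hG
  have hdvd := key _ fun j => smul_koszulFamily_mem_multiDer i a j
  have hdet : G ^ n * (pderiv a (f i) ^ (n - 1) * f i ^ m i) =
      (∏ l, f l ^ m l) * (G ^ (n - 1) * pderiv a (f i) ^ (n - 1)) := by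
    rw [← Finset.mul_prod_erase Finset.univ (fun l => f l ^ m l) (Finset.mem_univ i), ← hG]
    have hpowG : G ^ n = G ^ (n - 1) * G := by rw [← pow_succ, ← hn]
    rw [hpowG]
    ring
  rw [det_derivationMatrix_smul_koszulFamily, hdet] at hdvd
  rcases (hirr i).prime.dvd_or_dvd (hig.trans ((mul_dvd_mul_iff_left hF).1 hdvd)) with h | h
  · exact not_dvd_prod_erase_pow hcop hirr i ((hirr i).prime.dvd_of_dvd_pow h)
  · exact ha ((hirr i).prime.dvd_of_dvd_pow h)

end Saito

/-- **Saito–Ziegler criterion for multiderivations.** For pairwise coprime squarefree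
irreducible polynomials `f_1, …, f_r ∈ R = k[x_1, …, x_n]`, positive integers
`m = (m_1, …, m_r)` and multiderivations `δ_1, …, δ_n ∈ Der_m(f)`, the module `Der_m(f)`
is the (internal direct) sum `Rδ_1 ⊕ ⋯ ⊕ Rδ_n`, i.e. `δ_1, …, δ_n` form a free basis of
`Der_m(f)`, if and only if the determinant of the coefficient matrix `(δ_i(x_j))` equals
`u · f_1^{m_1} ⋯ f_r^{m_r}` for some nonzero constant `u ∈ k`. -/
theorem saito_ziegler_criterion {k : Type*} [Field k] [CharZero k] {n r : ℕ}
    (f : Fin r → MvPolynomial (Fin n) k) (m : Fin r → ℕ)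
    (hcop : ∀ i j, i ≠ j → IsRelPrime (f i) (f j))
    (hsqf : ∀ i, Squarefree (f i)) (hirr : ∀ i, Irreducible (f i))
    (hm : ∀ i, 0 < m i)
    (δ : Fin n → Derivation k (MvPolynomial (Fin n) k) (MvPolynomial (Fin n) k))
    (hδ : ∀ i, δ i ∈ multiDer f m) :
    (LinearIndependent (MvPolynomial (Fin n) k) δ ∧
        Submodule.span (MvPolynomial (Fin n) k) (Set.range δ) = multiDer f m) ↔
      ∃ u : k, u ≠ 0 ∧
        Matrix.det (Matrix.of fun i j => δ i (X j)) = C u * ∏ i, f i ^ m i := by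
  constructor
  · rintro ⟨-, hspan⟩
    obtain ⟨g, hg⟩ := prod_pow_dvd_det_derivationMatrix hcop hirr hδ
    have hunit := isUnit_of_det_derivationMatrix_eq_mul hcop hirr hspan hg
    obtain ⟨u, hu, rfl⟩ := isUnit_iff_eq_C_of_isReduced.1 hunit
    exact ⟨u, hu.ne_zero, hg.trans (mul_comm _ _)⟩
  · rintro ⟨u, hu, hdet⟩
    have hF : ∏ i, f i ^ m i ≠ 0 :=
      Finset.prod_ne_zero_iff.2 fun i _ => pow_ne_zero _ (hirr i).ne_zero
    have hne : (derivationMatrix δ).det ≠ 0 :=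
      hdet ▸ mul_ne_zero (C_ne_zero.2 hu) hF
    refine ⟨linearIndependent_of_det_derivationMatrix_ne_zero hne,
      le_antisymm (Submodule.span_le.2 (Set.range_subset_iff.2 hδ)) fun D hD => ?_⟩
    have hupd : ∀ i, (derivationMatrix δ).det ∣ (derivationMatrix (Function.update δ i D)).det := by
      intro i
      refine hdet.dvd.trans (((hu.isUnit.map C).mul_left_dvd).2
        (prod_pow_dvd_det_derivationMatrix hcop hirr fun j => ?_))
      by_cases hj : j = i
      · subst hj; simpa using hD
      · simpa [hj] using hδ j
    choose c hc using hupd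
    refine (Submodule.mem_span_range_iff_exists_fun _).2 ⟨c, ?_⟩
    refine derivation_ext fun j => mul_left_cancel₀ hne ?_
    have h := DFunLike.congr_fun (det_smul_eq_sum_s7 δ D) (X j : MvPolynomial (Fin n) k)
    simp only [hc, Derivation.smul_apply, derivation_sum_apply, smul_eq_mul, mul_assoc,
      ← Finset.mul_sum] at h
    simpa [derivation_sum_apply] using h.symm
end

section
/- Let f_1,…,f_s ∈ R = k[x_1,…,x_n], with 1 < s ≤ n−1, be algebraically independent over the field k of characteristic zero. Then the module Der(f_1,…,f_s) has rank n−s+1, i.e. dim_{Frac(R)}(Frac(R) ⊗_R Der(f_1,…,f_s)) = n−s+1. -/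
open MvPolynomial TensorProduct

/-- The module of logarithmic derivations associated to several polynomials,
`Der(f_1, …, f_s) = {δ ∈ Der_R : f_j·δ(f_i) = f_i·δ(f_j) for all i < j}`.
Since `Der_R` is the free rank-`n` module with basis `∂_1, …, ∂_n`, a derivation
`δ = Σ_t P_t ∂_t` is represented by its coefficient vector `P : Fin n → R`, and its
action on a polynomial `g` is `δ(g) = Σ_t P_t · ∂_t g`. -/
noncomputable def logDer {k : Type*} [Field k] {n s : ℕ}
    (f : Fin s → MvPolynomial (Fin n) k) :
    Submodule (MvPolynomial (Fin n) k) (Fin n → MvPolynomial (Fin n) k) where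
  carrier := {P | ∀ i j, i < j →
    f j * ∑ t, P t * pderiv t (f i) = f i * ∑ t, P t * pderiv t (f j)}
  add_mem' := fun {a b} ha hb i j hij => by
    simp only [Pi.add_apply, add_mul, Finset.sum_add_distrib, mul_add, ha i j hij, hb i j hij]
  zero_mem' := fun i j _ => by simp
  smul_mem' := fun c P hP i j hij => by
    simp only [Pi.smul_apply, smul_eq_mul, mul_assoc, ← Finset.mul_sum]
    rw [mul_left_comm, hP i j hij, mul_left_comm]

theorem Derivation.apply_eq_zero_of_isAlgebraic {A B : Type*} [CommRing A] [CommRing B]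
    [Algebra A B] [FaithfulSMul A B] [IsDomain B] [CharZero B] (D : Derivation A B B) {x : B}
    (hx : IsAlgebraic A x) : D x = 0 := by
  have hinj := FaithfulSMul.algebraMap_injective A B
  have : IsDomain A := hinj.isDomain
  have : CharZero A := (algebraMap A B).charZero
  obtain ⟨p, hp, hpx⟩ := hx
  induction hd : p.natDegree using Nat.strong_induction_on generalizing p with
  | _ d ih =>
    have hdeg : p.natDegree ≠ 0 := fun h => by
      rw [Polynomial.eq_C_of_natDegree_eq_zero h, Polynomial.aeval_C,
        map_eq_zero_iff _ hinj] at hpx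
      exact hp (by rw [Polynomial.eq_C_of_natDegree_eq_zero h, hpx, Polynomial.C_0])
    have h := D.map_aeval p x
    rw [hpx, D.map_zero, eq_comm, smul_eq_zero] at h
    exact h.elim
      (fun h' => ih _ (hd ▸ Polynomial.natDegree_derivative_lt hdeg) _
        (mt Polynomial.derivative_eq_zero.1 hdeg) h' rfl) id

theorem Derivation.eq_zero_of_isAlgebraic_adjoin {k B : Type*} [CommRing k] [CommRing B]
    [Algebra k B] [IsDomain B] [CharZero B] (D : Derivation k B B) {s : Set B}
    [Algebra.IsAlgebraic (Algebra.adjoin k s) B] (hs : ∀ x ∈ s, D x = 0) : D = 0 := by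
  have h0 : ∀ a ∈ Algebra.adjoin k s, D a = 0 :=
    D.eqOn_adjoin (D2 := 0) hs
  let D' : Derivation (Algebra.adjoin k s) B B :=
    Derivation.mk'
      { toFun := D
        map_add' := D.map_add
        map_smul' := fun a b => by simp [Subalgebra.smul_def, h0 a a.2] }
      D.leibniz
  ext x
  exact D'.apply_eq_zero_of_isAlgebraic (Algebra.IsAlgebraic.isAlgebraic x)

theorem LinearMap.finrank_range_add_finrank_ker_of_isDomain {R M N : Type*} [CommRing R]
    [IsDomain R] [AddCommGroup M] [Module R M] [Module.Finite R M] [AddCommGroup N] [Module R N]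
    (φ : M →ₗ[R] N) :
    Module.finrank R (LinearMap.range φ) + Module.finrank R (LinearMap.ker φ) =
      Module.finrank R M := by
  rw [← φ.quotKerEquivRange.finrank_eq, Submodule.finrank_quotient_add_finrank]

theorem Submodule.finrank_eq_iff_exists_smul_mem {R M : Type*} [CommRing R]
    [IsDomain R] [AddCommGroup M] [Module R M] [Module.Finite R M] (N : Submodule R M) :
    Module.finrank R N = Module.finrank R M ↔ ∀ w : M, ∃ d : R, d ≠ 0 ∧ d • w ∈ N := by
  have h := N.finrank_quotient_add_finrank
  trans Module.finrank R (M ⧸ N) = 0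
  · lia
  · rw [Module.finrank_eq_zero_iff, N.mkQ_surjective.forall]
    simp only [mkQ_apply, ← Quotient.mk_smul, Quotient.mk_eq_zero]

section

variable {k : Type*} [Field k] {n s : ℕ}

/-- The linear map sending the coefficient vector of a derivation `δ` to `(δ(f_i))_i`. -/
noncomputable def MvPolynomial.gradientMap {ι : Type*} (f : ι → MvPolynomial (Fin n) k) :
    (Fin n → MvPolynomial (Fin n) k) →ₗ[MvPolynomial (Fin n) k] (ι → MvPolynomial (Fin n) k) where
  toFun P i := ∑ t, P t * pderiv t (f i)
  map_add' P Q := by ext1 i; simp [add_mul, Finset.sum_add_distrib]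
  map_smul' c P := by ext1 i; simp [mul_assoc, Finset.mul_sum]

theorem MvPolynomial.gradientMap_apply {ι : Type*} (f : ι → MvPolynomial (Fin n) k)
    (P : Fin n → MvPolynomial (Fin n) k) (i : ι) :
    gradientMap f P i = mkDerivation k P (f i) := by
  have h : ∑ t, P t • pderiv t = mkDerivation k P := by
    refine derivation_ext fun i => ?_
    rw [← Derivation.coeFnAddMonoidHom_apply, map_sum, Finset.sum_apply]
    simp [pderiv_X, Pi.single_apply]
  rw [← h, ← Derivation.coeFnAddMonoidHom_apply, map_sum, Finset.sum_apply]
  simp [gradientMap]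

theorem IsTranscendenceBasis.gradientMap_injective [CharZero k] {ι : Type*}
    {f : ι → MvPolynomial (Fin n) k} (hf : IsTranscendenceBasis k f) :
    Function.Injective (gradientMap f) := by
  rw [injective_iff_map_eq_zero]
  intro P hP
  have := hf.isAlgebraic
  have hD : mkDerivation k P = 0 := by
    refine Derivation.eq_zero_of_isAlgebraic_adjoin (s := Set.range f) _ ?_
    rintro _ ⟨i, rfl⟩
    rw [← gradientMap_apply, hP, Pi.zero_apply]
  ext1 t
  rw [← mkDerivation_X k P t, hD, Derivation.zero_apply, Pi.zero_apply]

theorem AlgebraicIndependent.exists_smul_mem_range_gradientMap [CharZero k] {ι : Type*}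
    {f : ι → MvPolynomial (Fin n) k} (hf : AlgebraicIndependent k f)
    (w : ι → MvPolynomial (Fin n) k) :
    ∃ d : MvPolynomial (Fin n) k, d ≠ 0 ∧ d • w ∈ LinearMap.range (gradientMap f) := by
  obtain ⟨t, hft, ht⟩ := exists_isTranscendenceBasis_superset hf.to_subtype_range
  have hcard := ht.lift_cardinalMk_eq (IsTranscendenceBasis.mvPolynomial (Fin n) k)
  have : Finite t := by
    rw [← Cardinal.lt_aleph0_iff_finite, ← Cardinal.lift_lt_aleph0, hcard]
    simp
  have := Fintype.ofFinite t
  have hcard' : Fintype.card t = n := by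
    simpa using hcard
  let e (i : ι) : t := ⟨f i, hft ⟨i, rfl⟩⟩
  have he : Function.Injective e := fun i j h => hf.injective (congrArg Subtype.val h)
  obtain ⟨d, hd, P, hP⟩ := (Submodule.finrank_eq_iff_exists_smul_mem
    (LinearMap.range (gradientMap ((↑) : t → MvPolynomial (Fin n) k)))).1
    (by rw [LinearMap.finrank_range_of_inj ht.gradientMap_injective]; simp [hcard'])
    (Function.extend e w 0)
  refine ⟨d, hd, P, ?_⟩
  ext1 i
  simpa [he.extend_apply] using! congrFun hP (e i)

theorem AlgebraicIndependent.finrank_ker_gradientMap [CharZero k]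
    {f : Fin s → MvPolynomial (Fin n) k} (hf : AlgebraicIndependent k f) :
    Module.finrank (MvPolynomial (Fin n) k) (LinearMap.ker (gradientMap f)) = n - s := by
  have h := (gradientMap f).finrank_range_add_finrank_ker_of_isDomain
  rw [(Submodule.finrank_eq_iff_exists_smul_mem _).2 hf.exists_smul_mem_range_gradientMap] at h
  simp only [Module.finrank_fin_fun] at h
  lia

theorem mem_logDer {f : Fin s → MvPolynomial (Fin n) k} {P : Fin n → MvPolynomial (Fin n) k} :
    P ∈ logDer f ↔ ∀ i j, f j * gradientMap f P i = f i * gradientMap f P j := by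
  refine ⟨fun h i j => ?_, fun h i j _ => h i j⟩
  obtain hij | rfl | hij := lt_trichotomy i j
  exacts [h i j hij, rfl, (h j i hij).symm]

theorem ker_gradientMap_le_logDer (f : Fin s → MvPolynomial (Fin n) k) :
    LinearMap.ker (gradientMap f) ≤ logDer f := fun P hP => by
  rw [LinearMap.mem_ker] at hP
  simp [mem_logDer, hP]

theorem finrank_logDer [CharZero k] {f : Fin s → MvPolynomial (Fin n) k} [NeZero s]
    (hf : AlgebraicIndependent k f) :
    Module.finrank (MvPolynomial (Fin n) k) (logDer f) = n - s + 1 := by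
  have hf0 : f 0 ≠ 0 := hf.ne_zero 0
  let φ := LinearMap.proj 0 ∘ₗ gradientMap f ∘ₗ (logDer f).subtype
  have hker : LinearMap.ker φ = (LinearMap.ker (gradientMap f)).comap (logDer f).subtype := by
    ext ⟨P, hP⟩
    refine ⟨fun h => ?_, fun h => congrFun h 0⟩
    ext1 i
    have h0 : gradientMap f P 0 = 0 := h
    have := mem_logDer.1 hP i 0
    rw [h0, mul_zero] at this
    exact (mul_eq_zero.1 this).resolve_left hf0
  have hrange : Module.finrank (MvPolynomial (Fin n) k) (LinearMap.range φ) = 1 := by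
    refine le_antisymm ((Submodule.finrank_le _).trans_eq (Module.finrank_self _)) ?_
    obtain ⟨d, hd, P, hP⟩ := hf.exists_smul_mem_range_gradientMap f
    have hPf : P ∈ logDer f := mem_logDer.2 fun i j => by
      simp only [hP, Pi.smul_apply, smul_eq_mul]
      ring
    refine Module.finrank_pos_iff_exists_ne_zero.2 ⟨⟨φ ⟨P, hPf⟩, _, rfl⟩, ?_⟩
    have : φ ⟨P, hPf⟩ = d * f 0 := congrFun hP 0
    simp [this, hd, hf0]
  rw [← φ.finrank_range_add_finrank_ker_of_isDomain, hrange, hker,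
    (Submodule.comapSubtypeEquivOfLe (ker_gradientMap_le_logDer f)).finrank_eq,
    hf.finrank_ker_gradientMap, add_comm]

end

/-- For polynomials `f_1, …, f_s ∈ R = k[x_1, …, x_n]` with `1 < s ≤ n − 1` that are
algebraically independent over the field `k` of characteristic zero, the module
`Der(f_1, …, f_s)` has rank `n − s + 1`, i.e.
`dim_{Frac R}(Frac R ⊗_R Der(f_1, …, f_s)) = n − s + 1`. -/
theorem logDer_rank {k : Type*} [Field k] [CharZero k] {n s : ℕ}
    (hs : 1 < s) (hsn : s ≤ n - 1) (f : Fin s → MvPolynomial (Fin n) k)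
    (hf : AlgebraicIndependent k f) :
    Module.finrank (FractionRing (MvPolynomial (Fin n) k))
      (FractionRing (MvPolynomial (Fin n) k) ⊗[MvPolynomial (Fin n) k] logDer f)
      = n - s + 1 := by
  have : NeZero s := ⟨by lia⟩
  rw [IsFractionRing.finrank_right_eq (MvPolynomial (Fin n) k),
    IsLocalizedModule.finrank_eq (nonZeroDivisors (MvPolynomial (Fin n) k))
      (TensorProduct.mk (MvPolynomial (Fin n) k) (FractionRing (MvPolynomial (Fin n) k))
        (logDer f) 1) le_rfl,
    finrank_logDer hf]
end

section
/- Let k be a field of characteristic zero, R = k[x,y], and f = x² + y² + x. Let δ_1 = 2y(2x+1)∂_x + (4y²−1)∂_y and δ_2 = x(x+1)∂_x + (y/2 + xy)∂_y. Then δ_1(f) = 8y·f, δ_2(f) = (2x+1)·f, det(δ_1,δ_2) = f, and Der(f) = Rδ_1 ⊕ Rδ_2; in particular Der(f) is a free R-module. -/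
open MvPolynomial

/-- Genzmer's example: for `f = x² + y² + x` in `R = k[x,y]`, the derivations
`δ_1 = 2y(2x+1)∂_x + (4y²−1)∂_y` and `δ_2 = x(x+1)∂_x + (y/2 + xy)∂_y` satisfy
`δ_1(f) = 8y·f`, `δ_2(f) = (2x+1)·f` and `det(δ_1, δ_2) = f`, and they form a free basis
of `Der(f)`; in particular `Der(f)` is a free `R`-module. -/
theorem affine_conic_free {k : Type*} [Field k] [CharZero k]
    (f : MvPolynomial (Fin 2) k) (hfdef : f = X 0 ^ 2 + X 1 ^ 2 + X 0)
    (δ : Fin 2 → Derivation k (MvPolynomial (Fin 2) k) (MvPolynomial (Fin 2) k))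
    (hδ1 : δ 0 = mkDerivation k ![2 * X 1 * (2 * X 0 + 1), 4 * X 1 ^ 2 - 1])
    (hδ2 : δ 1 = mkDerivation k ![X 0 * (X 0 + 1), C ((2 : k)⁻¹) * X 1 + X 0 * X 1]) :
    δ 0 f = 8 * X 1 * f ∧
    δ 1 f = (2 * X 0 + 1) * f ∧
    Matrix.det (Matrix.of fun i j => δ i (X j)) = f ∧
    (LinearIndependent (MvPolynomial (Fin 2) k) δ ∧
      Submodule.span (MvPolynomial (Fin 2) k) (Set.range δ) = tangentDer f) ∧
    Module.Free (MvPolynomial (Fin 2) k) (tangentDer f) := by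
  have h2 : (2 : MvPolynomial (Fin 2) k) * C ((2 : k)⁻¹) = 1 := by
    rw [← map_ofNat (C : k →+* MvPolynomial (Fin 2) k) 2, ← C_mul,
      mul_inv_cancel₀ two_ne_zero, C_1]
  have hf0 : f ≠ 0 := by
    rintro rfl
    have h := congrArg (eval ![(1 : k), 0]) hfdef
    norm_num at h
  have h00 : δ 0 (X 0) = 2 * X 1 * (2 * X 0 + 1) := by simp [hδ1, mkDerivation_X]
  have h01 : δ 0 (X 1) = 4 * X 1 ^ 2 - 1 := by simp [hδ1, mkDerivation_X]
  have h10 : δ 1 (X 0) = X 0 * (X 0 + 1) := by simp [hδ2, mkDerivation_X]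
  have h11 : δ 1 (X 1) = C ((2 : k)⁻¹) * X 1 + X 0 * X 1 := by simp [hδ2, mkDerivation_X]
  have happly (D : Derivation k (MvPolynomial (Fin 2) k) (MvPolynomial (Fin 2) k)) :
      D f = (2 * X 0 + 1) * D (X 0) + 2 * X 1 * D (X 1) := by
    simp only [hfdef, map_add, Derivation.leibniz_pow, smul_eq_mul, nsmul_eq_mul]
    push_cast
    ring
  have hδ1f : δ 0 f = 8 * X 1 * f := by
    rw [happly, h00, h01, hfdef]
    ring
  have hδ2f : δ 1 f = (2 * X 0 + 1) * f := by
    rw [happly, h10, h11, hfdef]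
    linear_combination X 1 ^ 2 * h2
  have hdet : δ 0 (X 0) * δ 1 (X 1) - δ 0 (X 1) * δ 1 (X 0) = f := by
    rw [h00, h01, h10, h11, hfdef]
    linear_combination X 1 ^ 2 * (2 * X 0 + 1) * h2
  have hli : LinearIndependent (MvPolynomial (Fin 2) k) δ := by
    rw [Fintype.linearIndependent_iff]
    intro c hc
    have hX (j : Fin 2) : c 0 * δ 0 (X j) + c 1 * δ 1 (X j) = 0 := by
      simpa [Fin.sum_univ_two] using congrArg (fun D => D (X j)) hc
    have hc0 : c 0 * f = 0 := by
      linear_combination δ 1 (X 1) * hX 0 - δ 1 (X 0) * hX 1 - c 0 * hdet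
    have hc1 : c 1 * f = 0 := by
      linear_combination δ 0 (X 0) * hX 1 - δ 0 (X 1) * hX 0 - c 1 * hdet
    exact Fin.forall_fin_two.mpr
      ⟨(mul_eq_zero.mp hc0).resolve_right hf0, (mul_eq_zero.mp hc1).resolve_right hf0⟩
  have hspan : Submodule.span (MvPolynomial (Fin 2) k) (Set.range δ) = tangentDer f := by
    apply le_antisymm
    · rw [Submodule.span_le, Set.range_subset_iff, Fin.forall_fin_two]
      exact ⟨Dvd.intro_left _ hδ1f.symm, Dvd.intro_left _ hδ2f.symm⟩
    · rintro D ⟨g, hg⟩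
      rw [happly, hfdef] at hg
      rw [Submodule.mem_span_range_iff_exists_fun]
      refine ⟨![C ((2 : k)⁻¹) * X 1 * g - D (X 1), (2 * X 0 + 1) * g - 4 * D (X 0)], ?_⟩
      apply derivation_ext
      rw [Fin.forall_fin_two]
      simp only [Fin.sum_univ_two, Derivation.add_apply, Derivation.smul_apply, smul_eq_mul,
        Matrix.cons_val_zero, Matrix.cons_val_one, h00, h01, h10, h11]
      constructor
      · linear_combination X 1 ^ 2 * (2 * X 0 + 1) * g * h2 - (2 * X 0 + 1) * hg
      · linear_combination (2 * X 1 ^ 3 * g + X 0 * X 1 * g - 2 * X 1 * D (X 0)) * h2 - 2 * X 1 * hg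
  refine ⟨hδ1f, hδ2f, ?_, ⟨hli, hspan⟩, ?_⟩
  · simpa [Matrix.det_fin_two] using hdet
  · rw [← hspan]
    exact Module.Free.of_basis (Module.Basis.span hli)
end

section
/- Let k be a field of characteristic zero, R = k[x,y,z], and f = z(x² + yz). Let δ_E = x∂_x + y∂_y + z∂_z, δ_1 = z∂_x − 2x∂_y, and δ_2 = x∂_x + 4y∂_y − 2z∂_z. Then δ_1(f) = 0, δ_2(f) = 0, det(δ_E, δ_1, δ_2) = 6z(x² + yz), and Der(f) = Rδ_E ⊕ Rδ_1 ⊕ Rδ_2; in particular Der(f) is a free R-module. -/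
open MvPolynomial

theorem MvPolynomial.X_dvd_of_X_dvd_X_mul {R σ : Type*} [CommRing R] [IsDomain R] {i j : σ}
    (hij : i ≠ j) {p : MvPolynomial σ R} (h : (X i : MvPolynomial σ R) ∣ X j * p) : X i ∣ p :=
  (X_dvd_mul_iff.mp h).resolve_left fun hd => hij (X_dvd_X.mp hd)

/-- A triple `(a, b, c)` with `c * x² + 2 * x * z * a + z² * b + 2 * y * z * c` divisible by
`z * (x² + y * z)` is a combination of `(x, y, z)`, `(z, -2x, 0)` and `(x, 4y, -2z)`. -/
theorem exists_coeffs_of_conic_tangent_line {k : Type*} [Field k] [CharZero k]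
    {a b c g : MvPolynomial (Fin 3) k}
    (h : c * (X 0 ^ 2 + X 1 * X 2) + X 2 * (2 * X 0 * a + X 2 * b + X 1 * c) =
      X 2 * (X 0 ^ 2 + X 1 * X 2) * g) :
    ∃ u v w : MvPolynomial (Fin 3) k,
      a = u * X 0 + v * X 2 + w * X 0 ∧
      b = u * X 1 + v * -(2 * X 0) + w * (4 * X 1) ∧
      c = u * X 2 + w * -(2 * X 2) := by
  have hz : (X 2 : MvPolynomial (Fin 3) k) ≠ 0 := X_ne_zero 2
  have hx : (X 0 : MvPolynomial (Fin 3) k) ≠ 0 := X_ne_zero 0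
  obtain ⟨c, rfl⟩ : X 2 ∣ c := by
    refine X_dvd_of_X_dvd_X_mul (j := 0) (by decide) (X_dvd_of_X_dvd_X_mul (j := 0) (by decide)
      ⟨(X 0 ^ 2 + X 1 * X 2) * g - (2 * X 0 * a + X 2 * b + X 1 * c) - X 1 * c, ?_⟩)
    linear_combination h
  have h₁ : c * (X 0 ^ 2 + X 1 * X 2) + (2 * X 0 * a + X 2 * b + X 1 * (X 2 * c)) =
      (X 0 ^ 2 + X 1 * X 2) * g := mul_left_cancel₀ hz (by linear_combination h)
  obtain ⟨m, hm⟩ : X 0 ∣ g * X 1 - (b + 2 * c * X 1) :=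
    X_dvd_of_X_dvd_X_mul (j := 2) (by decide)
      ⟨2 * a + c * X 0 - g * X 0, by linear_combination -h₁⟩
  have hm' : 2 * a + c * X 0 - g * X 0 = X 2 * m :=
    mul_left_cancel₀ hx (by linear_combination h₁ + X 2 * hm)
  have h6 : (C (1 / 6 : k) : MvPolynomial (Fin 3) k) * 6 = 1 := by
    rw [← map_ofNat C 6, ← C_mul, one_div_mul_cancel (by norm_num), C_1]
  refine ⟨C (1 / 6) * (2 * g), C (1 / 6) * (3 * m), C (1 / 6) * (g - 3 * c), ?_, ?_, ?_⟩
  · linear_combination (3 * C (1 / 6)) * hm' - a * h6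
  · linear_combination (-6 * C (1 / 6)) * hm - b * h6
  · linear_combination (-(X 2 * c)) * h6

/-- The union of a smooth conic and a tangent line `f = z(x² + yz)` in `R = k[x,y,z]` is a
free divisor: with `δ_E = x∂_x + y∂_y + z∂_z`, `δ_1 = z∂_x − 2x∂_y` and
`δ_2 = x∂_x + 4y∂_y − 2z∂_z` one has `δ_1(f) = 0`, `δ_2(f) = 0`,
`det(δ_E, δ_1, δ_2) = 6z(x² + yz)`, and `Der(f) = Rδ_E ⊕ Rδ_1 ⊕ Rδ_2`; in particular
`Der(f)` is a free `R`-module. -/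
theorem conic_tangent_line_free {k : Type*} [Field k] [CharZero k]
    (f : MvPolynomial (Fin 3) k) (hfdef : f = X 2 * (X 0 ^ 2 + X 1 * X 2))
    (δ : Fin 3 → Derivation k (MvPolynomial (Fin 3) k) (MvPolynomial (Fin 3) k))
    (hδE : δ 0 = mkDerivation k ![X 0, X 1, X 2])
    (hδ1 : δ 1 = mkDerivation k ![X 2, -(2 * X 0), 0])
    (hδ2 : δ 2 = mkDerivation k ![X 0, 4 * X 1, -(2 * X 2)]) :
    δ 1 f = 0 ∧
    δ 2 f = 0 ∧
    Matrix.det (Matrix.of fun i j => δ i (X j)) = 6 * X 2 * (X 0 ^ 2 + X 1 * X 2) ∧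
    (LinearIndependent (MvPolynomial (Fin 3) k) δ ∧
      Submodule.span (MvPolynomial (Fin 3) k) (Set.range δ) = tangentDer f) ∧
    Module.Free (MvPolynomial (Fin 3) k) (tangentDer f) := by
  subst hfdef
  have hf (d : Derivation k (MvPolynomial (Fin 3) k) (MvPolynomial (Fin 3) k)) :
      d (X 2 * (X 0 ^ 2 + X 1 * X 2)) = d (X 2) * (X 0 ^ 2 + X 1 * X 2) +
        X 2 * (2 * X 0 * d (X 0) + X 2 * d (X 1) + X 1 * d (X 2)) := by
    simp only [Derivation.leibniz, Derivation.leibniz_pow, map_add, smul_eq_mul, nsmul_eq_mul]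
    push_cast
    ring
  have hE : δ 0 (X 2 * (X 0 ^ 2 + X 1 * X 2)) = X 2 * (X 0 ^ 2 + X 1 * X 2) * 3 := by
    rw [hf, hδE]
    simp [mkDerivation_X]
    ring
  have h1 : δ 1 (X 2 * (X 0 ^ 2 + X 1 * X 2)) = 0 := by
    rw [hf, hδ1]
    simp [mkDerivation_X]
    ring
  have h2 : δ 2 (X 2 * (X 0 ^ 2 + X 1 * X 2)) = 0 := by
    rw [hf, hδ2]
    simp [mkDerivation_X]
    ring
  have hdet : Matrix.det (Matrix.of fun i j => δ i (X j)) =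
      6 * X 2 * (X 0 ^ 2 + X 1 * X 2) := by
    simp [Matrix.det_fin_three, hδE, hδ1, hδ2, mkDerivation_X]
    ring
  have hdet0 : Matrix.det (Matrix.of fun i j => δ i (X j)) ≠ 0 := by
    rw [hdet]
    intro h
    simpa using congrArg (eval ![(1 : k), 0, 1]) h
  have hli : LinearIndependent (MvPolynomial (Fin 3) k) δ := by
    rw [Fintype.linearIndependent_iff]
    intro g hg
    refine congrFun (Matrix.eq_zero_of_vecMul_eq_zero hdet0 (funext fun j => ?_))
    simpa [Matrix.vecMul, dotProduct, Fin.sum_univ_three] using DFunLike.congr_fun hg (X j)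
  have hspan : Submodule.span (MvPolynomial (Fin 3) k) (Set.range δ) =
      tangentDer (X 2 * (X 0 ^ 2 + X 1 * X 2)) := by
    refine le_antisymm (Submodule.span_le.mpr ?_) ?_
    · rintro _ ⟨i, rfl⟩
      change X 2 * (X 0 ^ 2 + X 1 * X 2) ∣ δ i (X 2 * (X 0 ^ 2 + X 1 * X 2))
      fin_cases i
      exacts [⟨3, hE⟩, h1 ▸ dvd_zero _, h2 ▸ dvd_zero _]
    · rintro d ⟨g, hg⟩
      rw [hf] at hg
      obtain ⟨u, v, w, ha, hb, hc⟩ := exists_coeffs_of_conic_tangent_line hg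
      have hd : d = u • δ 0 + v • δ 1 + w • δ 2 := by
        refine derivation_ext fun i => ?_
        fin_cases i <;> simp [hδE, hδ1, hδ2, mkDerivation_X, ha, hb, hc]
      rw [hd]
      have hmem (i : Fin 3) : δ i ∈ Submodule.span (MvPolynomial (Fin 3) k) (Set.range δ) :=
        Submodule.subset_span ⟨i, rfl⟩
      exact add_mem (add_mem (Submodule.smul_mem _ _ (hmem 0)) (Submodule.smul_mem _ _ (hmem 1)))
        (Submodule.smul_mem _ _ (hmem 2))
  refine ⟨h1, h2, hdet, ⟨hli, hspan⟩, ?_⟩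
  rw [← hspan]
  exact Module.Free.of_basis (Module.Basis.span hli)
end

section
/- Let k be a field of characteristic zero, R = k[x_0,x_1,x_2,x_3], f = x_0² − x_1², and g = x_2³ + x_3³. Let δ_1 = x_1∂_{x_0} + x_0∂_{x_1}, δ_2 = x_3²∂_{x_2} − x_2²∂_{x_3}, and δ_3 = 3x_0∂_{x_0} + 3x_1∂_{x_1} + 2x_2∂_{x_2} + 2x_3∂_{x_3}. Then δ_1, δ_2, δ_3 ∈ Der(f,g), Der(f,g) = Rδ_1 ⊕ Rδ_2 ⊕ Rδ_3 (so Der(f,g) is a free R-module of rank 3), and moreover δ_1(f) = δ_1(g) = δ_2(f) = δ_2(g) = 0 and Der_0(f,g) = Rδ_1 ⊕ Rδ_2. -/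
open MvPolynomial

/-- The module of logarithmic derivations associated to a pair of polynomials,
`Der(f,g) = {δ ∈ Der_R : f·δ(g) = g·δ(f)}`. -/
def logDerPair {k : Type*} [Field k] {n : ℕ} (f g : MvPolynomial (Fin n) k) :
    Submodule (MvPolynomial (Fin n) k)
      (Derivation k (MvPolynomial (Fin n) k) (MvPolynomial (Fin n) k)) where
  carrier := {δ | f * δ g = g * δ f}
  add_mem' := fun {a b} ha hb => by
    show f * (a + b) g = g * (a + b) f
    simp only [Derivation.add_apply, mul_add]
    rw [ha, hb]
  zero_mem' := by simp
  smul_mem' := fun c δ hδ => by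
    show f * (c • δ) g = g * (c • δ) f
    simp only [Derivation.smul_apply, smul_eq_mul]
    rw [mul_left_comm, hδ, mul_left_comm]

/-- The module `Der_0(f,g) = {δ ∈ Der_R : δ(f) = δ(g) = 0}`. -/
def logDerPair0 {k : Type*} [Field k] {n : ℕ} (f g : MvPolynomial (Fin n) k) :
    Submodule (MvPolynomial (Fin n) k)
      (Derivation k (MvPolynomial (Fin n) k) (MvPolynomial (Fin n) k)) where
  carrier := {δ | δ f = 0 ∧ δ g = 0}
  add_mem' := fun ha hb => by simp_all
  zero_mem' := by simp
  smul_mem' := fun c δ hδ => by simp_all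

/-- A monic polynomial dividing a nonzero constant multiple of `u` divides `u`. -/
theorem Polynomial.Monic.dvd_of_dvd_C_mul {A : Type*} [CommRing A] [IsDomain A]
    {p u : Polynomial A} (hp : p.Monic) {c : A} (hc : c ≠ 0) (h : p ∣ Polynomial.C c * u) :
    p ∣ u := by
  rw [← Polynomial.smul_eq_C_mul, ← Polynomial.modByMonic_eq_zero_iff_dvd hp,
    Polynomial.smul_modByMonic] at h
  rw [← Polynomial.modByMonic_eq_zero_iff_dvd hp]
  exact (smul_eq_zero.mp h).resolve_left hc

section

variable {k : Type*} [Field k]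

theorem X_two_cube_add_X_three_cube_ne_zero :
    (X 2 ^ 3 + X 3 ^ 3 : MvPolynomial (Fin 4) k) ≠ 0 := by
  intro h
  have := congrArg (eval ![0, 0, 1, 0]) h
  simp at this

theorem X_zero_sq_sub_X_one_sq_ne_zero :
    (X 0 ^ 2 - X 1 ^ 2 : MvPolynomial (Fin 4) k) ≠ 0 := by
  intro h
  have := congrArg (eval ![1, 0, 0, 0]) h
  simp at this

theorem dvd_of_X_zero_sq_sub_X_one_sq_dvd_mul {u : MvPolynomial (Fin 4) k}
    (h : X 0 ^ 2 - X 1 ^ 2 ∣ (X 2 ^ 3 + X 3 ^ 3) * u) : X 0 ^ 2 - X 1 ^ 2 ∣ u := by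
  have hf : finSuccEquiv k 3 (X 0 ^ 2 - X 1 ^ 2) =
      Polynomial.X ^ 2 - Polynomial.C (X 0 ^ 2) := by
    rw [show (1 : Fin 4) = Fin.succ 0 from rfl]
    simp only [map_sub, map_pow, finSuccEquiv_X_zero, finSuccEquiv_X_succ]
  have hg : finSuccEquiv k 3 (X 2 ^ 3 + X 3 ^ 3) = Polynomial.C (X 1 ^ 3 + X 2 ^ 3) := by
    rw [show (2 : Fin 4) = Fin.succ 1 from rfl, show (3 : Fin 4) = Fin.succ 2 from rfl]
    simp only [map_add, map_pow, finSuccEquiv_X_succ]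
  have hne : (X 1 ^ 3 + X 2 ^ 3 : MvPolynomial (Fin 3) k) ≠ 0 := by
    intro h0
    have := congrArg (eval ![0, 1, 0]) h0
    simp at this
  rw [← map_dvd_iff (finSuccEquiv k 3), map_mul, hf, hg] at h
  rw [← map_dvd_iff (finSuccEquiv k 3), hf]
  exact (Polynomial.monic_X_pow_sub_C _ two_ne_zero).dvd_of_dvd_C_mul hne h

/-- The syzygies of a pair of powers of distinct variables are generated by the Koszul one. -/
theorem exists_eq_X_pow_mul_of_X_pow_mul_eq {σ : Type*} {i j : σ} (hij : i ≠ j) (n : ℕ)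
    {a b : MvPolynomial σ k} (h : X i ^ n * a = X j ^ n * b) :
    ∃ c, a = X j ^ n * c ∧ b = X i ^ n * c := by
  have hj : ¬ (X j : MvPolynomial σ k) ∣ X i ^ n := fun hd =>
    hij (X_dvd_X.mp (X_prime.dvd_of_dvd_pow hd)).symm
  obtain ⟨c, rfl⟩ := X_prime.pow_dvd_of_dvd_mul_left n hj ⟨b, h⟩
  refine ⟨c, rfl, mul_left_cancel₀ (pow_ne_zero n (X_ne_zero (R := k) j)) ?_⟩
  rw [← h, mul_left_comm]

theorem derivation_X_zero_sq_sub_X_one_sq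
    (D : Derivation k (MvPolynomial (Fin 4) k) (MvPolynomial (Fin 4) k)) :
    D (X 0 ^ 2 - X 1 ^ 2) = 2 * (X 0 * D (X 0) - X 1 * D (X 1)) := by
  simp only [map_sub, Derivation.leibniz_pow, smul_eq_mul, nsmul_eq_mul]
  push_cast
  ring

theorem derivation_X_two_cube_add_X_three_cube
    (D : Derivation k (MvPolynomial (Fin 4) k) (MvPolynomial (Fin 4) k)) :
    D (X 2 ^ 3 + X 3 ^ 3) = 3 * (X 2 ^ 2 * D (X 2) + X 3 ^ 2 * D (X 3)) := by
  simp only [map_add, Derivation.leibniz_pow, smul_eq_mul, nsmul_eq_mul]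
  push_cast
  ring

/-- Every derivation killing `x₀² − x₁²` and `x₂³ + x₃³` is a combination of the two Koszul
derivations. -/
theorem exists_eq_of_mem_logDerPair0 [CharZero k]
    {D : Derivation k (MvPolynomial (Fin 4) k) (MvPolynomial (Fin 4) k)}
    (hD : D ∈ logDerPair0 (X 0 ^ 2 - X 1 ^ 2) (X 2 ^ 3 + X 3 ^ 3)) :
    ∃ c d : MvPolynomial (Fin 4) k,
      c • mkDerivation k ![X 1, X 0, 0, 0] +
        d • mkDerivation k ![0, 0, X 3 ^ 2, -(X 2 ^ 2)] = D := by
  obtain ⟨hf, hg⟩ := hD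
  rw [derivation_X_zero_sq_sub_X_one_sq] at hf
  rw [derivation_X_two_cube_add_X_three_cube] at hg
  have hf' := (mul_eq_zero.mp hf).resolve_left (OfNat.ofNat_ne_zero 2)
  have hg' := (mul_eq_zero.mp hg).resolve_left (OfNat.ofNat_ne_zero 3)
  obtain ⟨c, h0, h1⟩ := exists_eq_X_pow_mul_of_X_pow_mul_eq (k := k)
    (show (0 : Fin 4) ≠ 1 by decide) 1 (a := D (X 0)) (b := D (X 1))
    (by linear_combination hf')
  obtain ⟨d, h2, h3⟩ := exists_eq_X_pow_mul_of_X_pow_mul_eq (k := k)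
    (show (2 : Fin 4) ≠ 3 by decide) 2 (a := D (X 2)) (b := -D (X 3))
    (by linear_combination hg')
  refine ⟨c, d, derivation_ext fun i => ?_⟩
  fin_cases i
  · simp [mkDerivation_X, h0, mul_comm]
  · simp [mkDerivation_X, h1, mul_comm]
  · simp [mkDerivation_X, h2, mul_comm]
  · simp [mkDerivation_X, neg_eq_iff_eq_neg.mp h3, mul_comm]

/-- A logarithmic derivation of the pair `x₀² − x₁²`, `x₂³ + x₃³` multiplies both polynomials by
the same factor. -/
theorem exists_eq_mul_of_mem_logDerPair
    {D : Derivation k (MvPolynomial (Fin 4) k) (MvPolynomial (Fin 4) k)}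
    (hD : D ∈ logDerPair (X 0 ^ 2 - X 1 ^ 2) (X 2 ^ 3 + X 3 ^ 3)) :
    ∃ h, D (X 0 ^ 2 - X 1 ^ 2) = h * (X 0 ^ 2 - X 1 ^ 2) ∧
      D (X 2 ^ 3 + X 3 ^ 3) = h * (X 2 ^ 3 + X 3 ^ 3) := by
  have hD' : (X 0 ^ 2 - X 1 ^ 2) * D (X 2 ^ 3 + X 3 ^ 3) =
    (X 2 ^ 3 + X 3 ^ 3) * D (X 0 ^ 2 - X 1 ^ 2) := hD
  obtain ⟨h, hh⟩ := dvd_of_X_zero_sq_sub_X_one_sq_dvd_mul ⟨_, hD'.symm⟩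
  refine ⟨h, by rw [hh, mul_comm], mul_left_cancel₀ X_zero_sq_sub_X_one_sq_ne_zero ?_⟩
  rw [hD', hh]
  ring

end

/-- For `f = x₀² − x₁²` and `g = x₂³ + x₃³` in `R = k[x₀,x₁,x₂,x₃]`, the derivations
`δ_1 = x₁∂_{x₀} + x₀∂_{x₁}`, `δ_2 = x₃²∂_{x₂} − x₂²∂_{x₃}` and
`δ_3 = 3x₀∂_{x₀} + 3x₁∂_{x₁} + 2x₂∂_{x₂} + 2x₃∂_{x₃}` belong to `Der(f,g)` and form a free
basis of it, so `Der(f,g)` is a free `R`-module of rank `3`; moreover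
`δ_1(f) = δ_1(g) = δ_2(f) = δ_2(g) = 0` and `Der_0(f,g) = Rδ_1 ⊕ Rδ_2`. -/
theorem pair_example_free {k : Type*} [Field k] [CharZero k]
    (f g : MvPolynomial (Fin 4) k)
    (hfdef : f = X 0 ^ 2 - X 1 ^ 2) (hgdef : g = X 2 ^ 3 + X 3 ^ 3)
    (δ : Fin 3 → Derivation k (MvPolynomial (Fin 4) k) (MvPolynomial (Fin 4) k))
    (hδ1 : δ 0 = mkDerivation k ![X 1, X 0, 0, 0])
    (hδ2 : δ 1 = mkDerivation k ![0, 0, X 3 ^ 2, -(X 2 ^ 2)])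
    (hδ3 : δ 2 = mkDerivation k ![3 * X 0, 3 * X 1, 2 * X 2, 2 * X 3]) :
    (∀ i, δ i ∈ logDerPair f g) ∧
    (LinearIndependent (MvPolynomial (Fin 4) k) δ ∧
      Submodule.span (MvPolynomial (Fin 4) k) (Set.range δ) = logDerPair f g) ∧
    Module.Free (MvPolynomial (Fin 4) k) (logDerPair f g) ∧
    Module.finrank (MvPolynomial (Fin 4) k) (logDerPair f g) = 3 ∧
    (δ 0 f = 0 ∧ δ 0 g = 0 ∧ δ 1 f = 0 ∧ δ 1 g = 0) ∧
    Submodule.span (MvPolynomial (Fin 4) k) {δ 0, δ 1} = logDerPair0 f g := by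
  subst hfdef hgdef
  have h0f : δ 0 (X 0 ^ 2 - X 1 ^ 2) = 0 := by
    rw [derivation_X_zero_sq_sub_X_one_sq, hδ1]
    simp [mkDerivation_X, mul_comm]
  have h0g : δ 0 (X 2 ^ 3 + X 3 ^ 3) = 0 := by
    rw [derivation_X_two_cube_add_X_three_cube, hδ1]
    simp [mkDerivation_X]
  have h1f : δ 1 (X 0 ^ 2 - X 1 ^ 2) = 0 := by
    rw [derivation_X_zero_sq_sub_X_one_sq, hδ2]
    simp [mkDerivation_X]
  have h1g : δ 1 (X 2 ^ 3 + X 3 ^ 3) = 0 := by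
    rw [derivation_X_two_cube_add_X_three_cube, hδ2]
    simp [mkDerivation_X, mul_comm]
  have h2f : δ 2 (X 0 ^ 2 - X 1 ^ 2) = 6 * (X 0 ^ 2 - X 1 ^ 2) := by
    rw [derivation_X_zero_sq_sub_X_one_sq, hδ3]
    simp [mkDerivation_X]
    ring
  have h2g : δ 2 (X 2 ^ 3 + X 3 ^ 3) = 6 * (X 2 ^ 3 + X 3 ^ 3) := by
    rw [derivation_X_two_cube_add_X_three_cube, hδ3]
    simp [mkDerivation_X]
    ring
  have hmem : ∀ i, δ i ∈ logDerPair (X 0 ^ 2 - X 1 ^ 2) (X 2 ^ 3 + X 3 ^ 3) := by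
    intro i
    change _ * _ = _ * _
    fin_cases i
    · simp [h0f, h0g]
    · simp [h1f, h1g]
    · change _ * δ 2 _ = _ * δ 2 _
      rw [h2f, h2g]
      ring
  have hli : LinearIndependent (MvPolynomial (Fin 4) k) δ := by
    rw [Fintype.linearIndependent_iff]
    intro c hc
    rw [Fin.sum_univ_three] at hc
    have hc2 : c 2 = 0 := by
      have h := DFunLike.congr_fun hc (X 0 ^ 2 - X 1 ^ 2)
      simp only [Derivation.add_apply, Derivation.smul_apply, h0f, h1f, h2f, mul_zero, zero_add,
        Derivation.zero_apply, smul_eq_mul] at h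
      exact (mul_eq_zero.mp h).resolve_right
        (mul_ne_zero (OfNat.ofNat_ne_zero 6) X_zero_sq_sub_X_one_sq_ne_zero)
    have hc0 : c 0 = 0 := by
      have h := DFunLike.congr_fun hc (X 0)
      simpa [hc2, hδ1, hδ2, mkDerivation_X] using h
    have hc1 : c 1 = 0 := by
      have h := DFunLike.congr_fun hc (X 2)
      simpa [hc2, hδ1, hδ2, mkDerivation_X] using h
    intro i
    fin_cases i
    exacts [hc0, hc1, hc2]
  have hspan0 : Submodule.span (MvPolynomial (Fin 4) k) {δ 0, δ 1} =
      logDerPair0 (X 0 ^ 2 - X 1 ^ 2) (X 2 ^ 3 + X 3 ^ 3) := by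
    apply le_antisymm
    · rw [Submodule.span_le, Set.pair_subset_iff]
      exact ⟨⟨h0f, h0g⟩, ⟨h1f, h1g⟩⟩
    · intro D hD
      rw [Submodule.mem_span_pair, hδ1, hδ2]
      exact exists_eq_of_mem_logDerPair0 hD
  have hspan : Submodule.span (MvPolynomial (Fin 4) k) (Set.range δ) =
      logDerPair (X 0 ^ 2 - X 1 ^ 2) (X 2 ^ 3 + X 3 ^ 3) := by
    apply le_antisymm
    · rw [Submodule.span_le]
      rintro _ ⟨i, rfl⟩
      exact hmem i
    · intro D hD
      obtain ⟨h, hf, hg⟩ := exists_eq_mul_of_mem_logDerPair hD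
      have h6 : (C (6⁻¹ : k) * 6 : MvPolynomial (Fin 4) k) = 1 := by
        rw [← map_ofNat C 6, ← C_mul, inv_mul_cancel₀ (OfNat.ofNat_ne_zero 6), C_1]
      have hD0 : D - (C 6⁻¹ * h) • δ 2 ∈
          logDerPair0 (X 0 ^ 2 - X 1 ^ 2) (X 2 ^ 3 + X 3 ^ 3) := by
        constructor
        · rw [Derivation.sub_apply, Derivation.smul_apply, hf, h2f, smul_eq_mul]
          linear_combination (-h * (X 0 ^ 2 - X 1 ^ 2)) * h6
        · rw [Derivation.sub_apply, Derivation.smul_apply, hg, h2g, smul_eq_mul]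
          linear_combination (-h * (X 2 ^ 3 + X 3 ^ 3)) * h6
      rw [← hspan0] at hD0
      rw [← sub_add_cancel D ((C 6⁻¹ * h) • δ 2)]
      refine add_mem (Submodule.span_mono ?_ hD0)
        (Submodule.smul_mem _ _ (Submodule.subset_span ⟨2, rfl⟩))
      exact Set.pair_subset_iff.mpr ⟨⟨0, rfl⟩, ⟨1, rfl⟩⟩
  refine ⟨hmem, ⟨hli, hspan⟩, ?_, ?_, ⟨h0f, h0g, h1f, h1g⟩, hspan0⟩
  · rw [← hspan]
    exact Module.Free.of_basis (Module.Basis.span hli)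
  · rw [← hspan, finrank_span_eq_card hli, Fintype.card_fin]
end
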